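/- arXiv:2512.12252 — 3 statements merged into one kernel-verified Lean document; each statement's English description precedes it below -/
import Mathlib

section
/- Let G ≥ 1, and let ε, q : Fin G → ℝ with ε_g > 0 and q_g > 0 for all g, and let b > 0, c ≥ 0, n ≥ 0, M be real numbers. Set S = Σ_g 1/ε_g, I = Σ_g (1/ε_g) · ln(q_g · ε_g), and for each g define δ_g = (1/(q_g · ε_g)) · exp(−((M − c·n)/(b·e) − I)/S), where e = exp(1). Then each δ_g > 0 and the memory constraint b · Σ_g (e/ε_g) · ln(1/δ_g) + c·n = M holds exactly. -/
/-- The closed-form KKT solution (interior case) satisfies positivity and the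
memory-budget equality constraint exactly. -/
theorem kkt_solution_satisfies_memory_constraint
    (G : ℕ) (hG : 1 ≤ G) (ε q : Fin G → ℝ)
    (hε : ∀ g, 0 < ε g) (hq : ∀ g, 0 < q g)
    (b c n M : ℝ) (hb : 0 < b) (hc : 0 ≤ c) (hn : 0 ≤ n)
    (S I : ℝ) (hS : S = ∑ g, 1 / ε g)
    (hI : I = ∑ g, (1 / ε g) * Real.log (q g * ε g))
    (δ : Fin G → ℝ)
    (hδ : ∀ g, δ g = (1 / (q g * ε g)) *
      Real.exp (-(((M - c * n) / (b * Real.exp 1) - I) / S))) :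
    (∀ g, 0 < δ g) ∧
      b * (∑ g, (Real.exp 1 / ε g) * Real.log (1 / δ g)) + c * n = M := by
  have hqε : ∀ g, 0 < q g * ε g := fun g => mul_pos (hq g) (hε g)
  have hSpos : 0 < S := by
    rw [hS]
    exact Finset.sum_pos (fun g _ => one_div_pos.mpr (hε g)) ⟨⟨0, hG⟩, Finset.mem_univ _⟩
  refine ⟨fun g => ?_, ?_⟩
  · rw [hδ g]
    exact mul_pos (one_div_pos.mpr (hqε g)) (Real.exp_pos _)
  set t := ((M - c * n) / (b * Real.exp 1) - I) / S
  have hlog : ∀ g, Real.log (1 / δ g) = Real.log (q g * ε g) + t := fun g => by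
    rw [hδ g, one_div, Real.log_inv,
      Real.log_mul (one_div_pos.mpr (hqε g)).ne' (Real.exp_pos _).ne', Real.log_exp,
      one_div, Real.log_inv]
    ring
  have hsum : ∑ g, (Real.exp 1 / ε g) * Real.log (1 / δ g) = Real.exp 1 * (I + S * t) := by
    rw [hI, hS, Finset.sum_mul, ← Finset.sum_add_distrib, Finset.mul_sum]
    refine Finset.sum_congr rfl fun g _ => ?_
    rw [hlog g]
    ring
  have hSt : S * t = (M - c * n) / (b * Real.exp 1) - I := mul_div_cancel₀ _ hSpos.ne'
  have he : Real.exp 1 ≠ 0 := (Real.exp_pos 1).ne'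
  rw [hsum, hSt]
  field_simp
  ring
end

section
/- Let G ≥ 1, and let ε, q : Fin G → ℝ with ε_g > 0 and q_g > 0 for all g, let b > 0, c ≥ 0, n ≥ 0, M be real numbers, and set S = Σ_g 1/ε_g, I = Σ_g (1/ε_g)·ln(q_g·ε_g), K = (M − c·n)/(b·e) where e = exp(1). Define δ*_g = (1/(q_g·ε_g)) · exp(−(K − I)/S), and assume δ*_g ≤ 1 for all g. Then for every δ : Fin G → ℝ satisfying 0 < δ_g ≤ 1 for all g and Σ_g (1/ε_g)·ln(1/δ_g) = K, one has Σ_g q_g · δ*_g ≤ Σ_g q_g · δ_g. -/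
/-- Weighted tangent-line inequality for `exp`: if `t` has weighted mean `t₀`, then
the weighted mean of `exp ∘ t` is at least `exp t₀`. -/
theorem sum_mul_exp_le_sum_mul_exp {ι : Type*} (s : Finset ι) (w t : ι → ℝ) (t₀ : ℝ)
    (hw : ∀ i ∈ s, 0 ≤ w i) (ht : ∑ i ∈ s, w i * t i = (∑ i ∈ s, w i) * t₀) :
    ∑ i ∈ s, w i * Real.exp t₀ ≤ ∑ i ∈ s, w i * Real.exp (t i) := by
  calc ∑ i ∈ s, w i * Real.exp t₀
      = ∑ i ∈ s, w i * (Real.exp t₀ * (t i - t₀ + 1)) := by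
        have h : ∀ i, w i * (Real.exp t₀ * (t i - t₀ + 1)) =
            Real.exp t₀ * (w i * t i) - Real.exp t₀ * t₀ * w i + w i * Real.exp t₀ :=
          fun i => by ring
        simp only [h, Finset.sum_add_distrib, Finset.sum_sub_distrib, ← Finset.mul_sum, ht]
        ring
    _ ≤ ∑ i ∈ s, w i * Real.exp (t i) := by
        refine Finset.sum_le_sum fun i hi => mul_le_mul_of_nonneg_left ?_ (hw i hi)
        calc Real.exp t₀ * (t i - t₀ + 1) ≤ Real.exp t₀ * Real.exp (t i - t₀) := by
              gcongr
              exact Real.add_one_le_exp _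
          _ = Real.exp (t i) := by rw [← Real.exp_add, add_sub_cancel]

/-- Global optimality of the closed-form KKT solution δ* in the interior case. -/
theorem kkt_solution_optimal
    (G : ℕ) (hG : 1 ≤ G) (ε q : Fin G → ℝ)
    (hε : ∀ g, 0 < ε g) (hq : ∀ g, 0 < q g)
    (b c n M : ℝ) (hb : 0 < b) (hc : 0 ≤ c) (hn : 0 ≤ n)
    (S I K : ℝ) (hS : S = ∑ g, 1 / ε g)
    (hI : I = ∑ g, (1 / ε g) * Real.log (q g * ε g))
    (hK : K = (M - c * n) / (b * Real.exp 1))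
    (δstar : Fin G → ℝ)
    (hδstar : ∀ g, δstar g = (1 / (q g * ε g)) * Real.exp (-((K - I) / S)))
    (hδstarle : ∀ g, δstar g ≤ 1)
    (δ : Fin G → ℝ) (hδpos : ∀ g, 0 < δ g) (hδle : ∀ g, δ g ≤ 1)
    (hcon : ∑ g, (1 / ε g) * Real.log (1 / δ g) = K) :
    ∑ g, q g * δstar g ≤ ∑ g, q g * δ g := by
  have hne : ∀ g, ε g ≠ 0 := fun g => (hε g).ne'
  have hSpos : 0 < S := by
    have : Nonempty (Fin G) := ⟨⟨0, hG⟩⟩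
    rw [hS]
    exact Finset.sum_pos (fun g _ => one_div_pos.mpr (hε g)) Finset.univ_nonempty
  have hmean : ∑ g, 1 / ε g * Real.log (q g * ε g * δ g) =
      (∑ g, 1 / ε g) * -((K - I) / S) := by
    have hlog : ∀ g, 1 / ε g * Real.log (q g * ε g * δ g) =
        1 / ε g * Real.log (q g * ε g) - 1 / ε g * Real.log (1 / δ g) := fun g => by
      rw [Real.log_mul (mul_pos (hq g) (hε g)).ne' (hδpos g).ne', one_div (δ g), Real.log_inv]
      ring
    simp only [hlog, Finset.sum_sub_distrib]
    rw [← hI, hcon, ← hS]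
    field_simp
    ring
  have key := sum_mul_exp_le_sum_mul_exp Finset.univ (fun g => 1 / ε g)
    (fun g => Real.log (q g * ε g * δ g)) (-((K - I) / S))
    (fun g _ => (one_div_pos.mpr (hε g)).le) hmean
  convert key using 2 with g _ g _
  · rw [hδstar]
    have := hne g
    have := (hq g).ne'
    field_simp
  · rw [Real.exp_log (mul_pos (mul_pos (hq g) (hε g)) (hδpos g))]
    have := hne g
    field_simp
end

section
/- Let G ≥ 1 and let u, v : Fin G → ℝ with u_g > 0, v_g > 0 for all g and Σ_g u_g = 1, Σ_g v_g = 1. Let ε > 0, N > 0, N_UB with 0 ≤ N_UB < N, q_UB with 0 ≤ q_UB < 1, b > 0, c ≥ 0, n ≥ 0, M be real numbers, and define ε_g = εN/((N − N_UB)·u_g) and q_g = v_g·(1 − q_UB). With S = Σ_g 1/ε_g, I = Σ_g (1/ε_g)·ln(q_g·ε_g), and δ*_g = (1/(q_g·ε_g))·exp(−((M − c·n)/(b·e) − I)/S) where e = exp(1), one has Σ_g q_g·δ*_g = (1 − q_UB) · exp(−εN(M − c·n)/(b·e·(N − N_UB))) · exp(−Σ_g u_g·ln(u_g/v_g)). 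-/
/-- KL-divergence form of the minimized objective (Equation func:minimum of the paper). -/
theorem objective_kl_form
    (G : ℕ) (hG : 1 ≤ G) (u v : Fin G → ℝ)
    (hu : ∀ g, 0 < u g) (hv : ∀ g, 0 < v g)
    (hu1 : ∑ g, u g = 1) (hv1 : ∑ g, v g = 1)
    (ε N NUB qUB b c n M : ℝ)
    (hε : 0 < ε) (hN : 0 < N) (hNUB0 : 0 ≤ NUB) (hNUB : NUB < N)
    (hqUB0 : 0 ≤ qUB) (hqUB : qUB < 1)
    (hb : 0 < b) (hc : 0 ≤ c) (hn : 0 ≤ n)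
    (εg qg : Fin G → ℝ)
    (hεg : ∀ g, εg g = ε * N / ((N - NUB) * u g))
    (hqg : ∀ g, qg g = v g * (1 - qUB))
    (S I : ℝ) (hS : S = ∑ g, 1 / εg g)
    (hI : I = ∑ g, (1 / εg g) * Real.log (qg g * εg g))
    (δstar : Fin G → ℝ)
    (hδstar : ∀ g, δstar g = (1 / (qg g * εg g)) *
      Real.exp (-(((M - c * n) / (b * Real.exp 1) - I) / S))) :
    ∑ g, qg g * δstar g =
      (1 - qUB) *
        Real.exp (-(ε * N * (M - c * n) / (b * Real.exp 1 * (N - NUB)))) *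
        Real.exp (-(∑ g, u g * Real.log (u g / v g))) := by
  have hD : 0 < N - NUB := sub_pos.mpr hNUB
  have hQ : 0 < 1 - qUB := sub_pos.mpr hqUB
  obtain ⟨k, hk⟩ : ∃ k, k = (N - NUB) / (ε * N) := ⟨_, rfl⟩
  have hk0 : 0 < k := hk ▸ by positivity
  have hinv : ∀ g, 1 / εg g = k * u g := fun g => by
    have := hu g
    rw [hεg, hk]
    field_simp
  have hlog : ∀ g, Real.log (qg g * εg g) =
      Real.log ((1 - qUB) / k) - Real.log (u g / v g) := fun g => by
    have hug := hu g
    have hvg := hv g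
    rw [← Real.log_div (by positivity) (by positivity), hεg, hqg, hk]
    congr 1
    field_simp
  have hSk : S = k := by
    simp_rw [hS, hinv, ← Finset.mul_sum, hu1, mul_one]
  have hIk : I = k * (Real.log ((1 - qUB) / k) - ∑ g, u g * Real.log (u g / v g)) := by
    simp_rw [hI, hinv, hlog, mul_assoc, ← Finset.mul_sum, mul_sub, Finset.sum_sub_distrib,
      ← Finset.sum_mul, hu1, one_mul, mul_sub]
  have hexp : -(((M - c * n) / (b * Real.exp 1) - I) / S) =
      Real.log ((1 - qUB) / k) + -(ε * N * (M - c * n) / (b * Real.exp 1 * (N - NUB))) +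
        -(∑ g, u g * Real.log (u g / v g)) := by
    have hdiv : (M - c * n) / (b * Real.exp 1) / k =
        ε * N * (M - c * n) / (b * Real.exp 1 * (N - NUB)) := by
      rw [hk]
      field_simp
    rw [hSk, hIk, sub_div, hdiv, mul_div_cancel_left₀ _ hk0.ne']
    ring
  have hterm : ∀ g, qg g * δstar g =
      k * u g * Real.exp (-(((M - c * n) / (b * Real.exp 1) - I) / S)) := fun g => by
    have hq : qg g ≠ 0 := by
      rw [hqg]
      exact (mul_pos (hv g) hQ).ne'
    rw [hδstar, ← hinv, ← mul_assoc, ← div_div, mul_div_assoc', mul_one_div_cancel hq]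
  simp_rw [hterm]
  rw [← Finset.sum_mul, ← Finset.mul_sum, hu1, mul_one, hexp, Real.exp_add, Real.exp_add,
    Real.exp_log (div_pos hQ hk0), ← mul_assoc, ← mul_assoc, mul_div_cancel₀ _ hk0.ne']
end
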